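/- Let (b_1, …, b_k) be a simple continued fraction expansion (SCFE) whose value cf(b_1, …, b_k) is not equal to 1 or −1, let b' = (−b_k, …, −b_2, −b_1, −1, b_1 − 1, b_2, …, b_k), and let N ∈ ℤ. If |N + cf(b')| < 1, then N = 0 or N = sgn(b_k). -/

import Mathlib

/-- Continued fraction value of a list of integers: `cf [] = 0`,
`cf (b :: t) = 1 / (b - cf t)`, computed in `ℚ` (with the convention `1/0 = 0`). -/
def cf : List ℤ → ℚ
  | [] => 0
  | b :: t => 1 / ((b : ℚ) - cf t)

/-- The evaluation of a continued fraction is well-defined if no division by zero occurs. -/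
def cfWD : List ℤ → Prop
  | [] => True
  | b :: t => ((b : ℚ) ≠ cf t) ∧ cfWD t

/-- A nonempty list of integers `(b_1, …, b_k)` is a simple continued fraction expansion:
consecutive coefficients have non-positive product (alternating signs), every coefficient
except possibly the first is nonzero, and the last coefficient has absolute value at least 2. -/
def SCFE (l : List ℤ) : Prop :=
  l ≠ [] ∧
  (∀ i, i + 1 < l.length → l.getD i 0 * l.getD (i + 1) 0 ≤ 0) ∧
  (∀ i, 0 < i → i < l.length → l.getD i 0 ≠ 0) ∧
  2 ≤ |l.getLastD 0|

/-- The list b' = (−b_k, …, −b_2, −b_1, −1, b_1 − 1, b_2, …, b_k). -/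
def bPrime (b : List ℤ) : List ℤ :=
  (b.map fun x => -x).reverse ++ [-1] ++ [b.headD 0 - 1] ++ b.tail

theorem SCFE.tail {a c : ℤ} {l : List ℤ} (h : SCFE (a :: c :: l)) :
    a * c ≤ 0 ∧ c ≠ 0 ∧ SCFE (c :: l) := by
  obtain ⟨-, hs, hn, hl⟩ := h
  refine ⟨by simpa using hs 0 (by simp), by simpa using hn 1 (by simp) (by simp), by simp,
    fun i hi => ?_, fun i hi hi' => ?_, by simpa using hl⟩
  · simpa using hs (i + 1) (by simpa using hi)
  · simpa using hn (i + 1) (by simp) (by simpa using hi')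

theorem SCFE.two_le_abs {a : ℤ} (h : SCFE [a]) : 2 ≤ |a| := by
  simpa using h.2.2.2

theorem one_div_mem_of_le_neg_one {d : ℚ} (h : d ≤ -1) : -1 ≤ 1 / d ∧ 1 / d ≤ 0 := by
  have hd : d < 0 := by linarith
  exact ⟨by rw [le_div_iff_of_neg hd]; linarith, (one_div_neg.2 hd).le⟩

theorem one_div_mem_of_one_le {d : ℚ} (h : 1 ≤ d) : 0 ≤ 1 / d ∧ 1 / d ≤ 1 := by
  have hd : 0 < d := by linarith
  exact ⟨(one_div_pos.2 hd).le, by rw [div_le_iff₀ hd]; linarith⟩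

theorem one_div_mem_of_lt_neg_one {d : ℚ} (h : d < -1) : -1 < 1 / d ∧ 1 / d < 0 := by
  have hd : d < 0 := by linarith
  exact ⟨by rw [lt_div_iff_of_neg hd]; linarith, one_div_neg.2 hd⟩

theorem one_div_mem_of_one_lt {d : ℚ} (h : 1 < d) : 0 < 1 / d ∧ 1 / d < 1 := by
  have hd : 0 < d := by linarith
  exact ⟨one_div_pos.2 hd, by rw [div_lt_iff₀ hd]; linarith⟩

/-- A simple continued fraction expansion with nonzero first coefficient has a value in the open
unit interval on the side of that coefficient. -/
theorem SCFE.cf_bounds {l : List ℤ} : ∀ {a : ℤ}, SCFE (a :: l) →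
    (0 < a → 0 < cf (a :: l) ∧ cf (a :: l) < 1) ∧
      (a < 0 → -1 < cf (a :: l) ∧ cf (a :: l) < 0) := by
  induction l with
  | nil =>
    intro a h
    have h2 := h.two_le_abs
    simp only [cf, sub_zero]
    refine ⟨fun ha => one_div_mem_of_one_lt ?_, fun ha => one_div_mem_of_lt_neg_one ?_⟩
    · rw [abs_of_pos ha] at h2
      exact_mod_cast h2
    · rw [abs_of_neg ha] at h2
      have : a < -1 := by omega
      exact_mod_cast this
  | cons c m ih =>
    intro a h
    obtain ⟨hac, hc, ht⟩ := h.tail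
    obtain ⟨hp, hn⟩ := ih ht
    rw [cf.eq_2 a]
    refine ⟨fun ha => one_div_mem_of_one_lt ?_, fun ha => one_div_mem_of_lt_neg_one ?_⟩
    · have hc' : c < 0 := by
        rcases lt_or_gt_of_ne hc with h | h
        · exact h
        · nlinarith
      have : (1 : ℚ) ≤ a := by exact_mod_cast ha
      linarith [(hn hc').2]
    · have hc' : 0 < c := by
        rcases lt_or_gt_of_ne hc with h | h
        · nlinarith
        · exact h
      have : (a : ℚ) ≤ -1 := by exact_mod_cast (by omega : a ≤ -1)
      linarith [(hp hc').1]

/-- The rational `z` lies in the closed unit interval on the side opposite to `a`. -/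
def OppositeUnit (a : ℤ) (z : ℚ) : Prop :=
  (0 < a → -1 ≤ z ∧ z ≤ 0) ∧ (a < 0 → 0 ≤ z ∧ z ≤ 1)

theorem OppositeUnit.step {a c : ℤ} {z : ℚ} (h : OppositeUnit a z) (ha : a ≠ 0) (hac : a * c ≤ 0) :
    OppositeUnit c (1 / (((-c : ℤ) : ℚ) - z)) := by
  refine ⟨fun hc => one_div_mem_of_le_neg_one ?_, fun hc => one_div_mem_of_one_le ?_⟩
  · have ha' : a < 0 := by
      rcases lt_or_gt_of_ne ha with h | h
      · exact h
      · nlinarith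
    have : (1 : ℚ) ≤ c := by exact_mod_cast hc
    push_cast
    linarith [(h.2 ha').1]
  · have ha' : 0 < a := by
      rcases lt_or_gt_of_ne ha with h | h
      · nlinarith
      · exact h
    have : (c : ℚ) ≤ -1 := by exact_mod_cast (by omega : c ≤ -1)
    push_cast
    linarith [(h.1 ha').2]

theorem OppositeUnit.reverse_append {l : List ℤ} : ∀ {a : ℤ} {r : List ℤ}, SCFE (a :: l) →
    a ≠ 0 → OppositeUnit a (cf (-a :: r)) →
    OppositeUnit ((a :: l).getLastD 0) (cf ((l.map fun x => -x).reverse ++ (-a :: r))) := by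
  induction l with
  | nil => intro a r _ _ h; simpa using h
  | cons c m ih =>
    intro a r hs ha h
    obtain ⟨hac, hc, ht⟩ := hs.tail
    have := ih (r := -a :: r) ht hc (by rw [cf.eq_2 (-c)]; exact h.step ha hac)
    simpa using this

theorem OppositeUnit.eq_zero_or_eq_sign {a N : ℤ} {z : ℚ} (h : OppositeUnit a z) (ha : a ≠ 0)
    (hN : |(N : ℚ) + z| < 1) : N = 0 ∨ N = Int.sign a := by
  obtain ⟨h1, h2⟩ := abs_lt.1 hN
  rcases lt_or_gt_of_ne ha with ha | ha
  · obtain ⟨h3, h4⟩ := h.2 ha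
    have h5 : (-2 : ℤ) < N := by
      have : (-2 : ℚ) < N := by linarith
      exact_mod_cast this
    have h6 : N < (1 : ℤ) := by
      have : (N : ℚ) < 1 := by linarith
      exact_mod_cast this
    rw [Int.sign_eq_neg_one_of_neg ha]
    omega
  · obtain ⟨h3, h4⟩ := h.1 ha
    have h5 : (-1 : ℤ) < N := by
      have : (-1 : ℚ) < N := by linarith
      exact_mod_cast this
    have h6 : N < (2 : ℤ) := by
      have : (N : ℚ) < 2 := by linarith
      exact_mod_cast this
    rw [Int.sign_eq_one_of_pos ha]
    omega

theorem cf_neg_one_cons_sub_one {a : ℤ} {l : List ℤ} (h0 : (a : ℚ) - cf l ≠ 0)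
    (h1 : (a : ℚ) - cf l ≠ 1) : cf (-1 :: (a - 1) :: l) = 1 / ((a : ℚ) - cf l) - 1 := by
  simp only [cf]
  push_cast
  generalize cf l = t at *
  have h2 : (a : ℚ) - 1 - t ≠ 0 := fun h => h1 (by linarith)
  have h3 : (-1 : ℚ) - 1 / ((a : ℚ) - 1 - t) = -(((a : ℚ) - t) / ((a : ℚ) - 1 - t)) := by
    field_simp
    ring
  rw [h3]
  field_simp
  ring

/-- If the first coefficient is neither `0` nor `1`, the turning point of `bPrime` already has its
value on the expected side. -/
theorem SCFE.oppositeUnit_turn {a : ℤ} {l : List ℤ} (h : SCFE (a :: l)) (ha0 : a ≠ 0)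
    (ha1 : a ≠ 1) : OppositeUnit a (cf (-a :: -1 :: (a - 1) :: l)) := by
  obtain ⟨hp, hn⟩ := h.cf_bounds
  rw [cf.eq_2 a] at hp hn
  have h0 : (a : ℚ) - cf l ≠ 0 := by
    intro h0
    rw [h0] at hp hn
    rcases lt_or_gt_of_ne ha0 with h | h
    · simpa using (hn h).2
    · simpa using (hp h).1
  have h1 : (a : ℚ) - cf l ≠ 1 := by
    intro h1
    rw [h1] at hp hn
    rcases lt_or_gt_of_ne ha0 with h | h
    · exact absurd (hn h).2 (by norm_num)
    · exact absurd (hp h).2 (by norm_num)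
  rw [cf.eq_2 (-a), cf_neg_one_cons_sub_one h0 h1]
  refine ⟨fun ha => one_div_mem_of_le_neg_one ?_, fun ha => one_div_mem_of_one_le ?_⟩
  · have h2 : (2 : ℚ) ≤ a := by exact_mod_cast (by omega : 2 ≤ a)
    push_cast
    linarith [(hp ha).1]
  · have h2 : (a : ℚ) ≤ -1 := by exact_mod_cast (by omega : a ≤ -1)
    push_cast
    linarith [(hn ha).2]

theorem SCFE.oppositeUnit_turn_one {c : ℤ} {m : List ℤ} (h : SCFE (1 :: c :: m)) :
    OppositeUnit c (cf (-c :: -1 :: -1 :: (1 - 1) :: c :: m)) := by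
  obtain ⟨hac, hc, ht⟩ := h.tail
  have hc' : c < 0 := by omega
  obtain ⟨h1, h2⟩ := ht.cf_bounds.2 hc'
  rw [cf.eq_2 (-c), cf.eq_2 (-1), cf_neg_one_cons_sub_one (by push_cast; linarith)
    (by push_cast; linarith)]
  refine ⟨fun _ => by omega, fun _ => one_div_mem_of_one_le ?_⟩
  have hcq : (c : ℚ) ≤ -1 := by exact_mod_cast (by omega : c ≤ -1)
  push_cast
  generalize cf (c :: m) = t at *
  have : (1 : ℚ) / (-1 - (1 / (1 - t) - 1)) = t - 1 := by
    have : (1 : ℚ) - t ≠ 0 := by linarith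
    have h3 : (-1 : ℚ) - (1 / (1 - t) - 1) = -(1 / (1 - t)) := by ring
    rw [h3]
    field_simp
    ring
  rw [this]
  linarith

theorem SCFE.oppositeUnit_turn_zero {c : ℤ} {m : List ℤ} (h : SCFE (0 :: c :: m)) :
    OppositeUnit c (cf (-c :: -0 :: -1 :: (0 - 1) :: c :: m)) := by
  obtain ⟨-, hc, ht⟩ := h.tail
  obtain ⟨hp, hn⟩ := ht.cf_bounds
  have hval : cf (c :: m) ≠ 0 ∧ -1 < cf (c :: m) := by
    rcases lt_or_gt_of_ne hc with h | h
    · exact ⟨(hn h).2.ne, (hn h).1⟩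
    · exact ⟨(hp h).1.ne', by linarith [(hp h).1]⟩
  obtain ⟨h0, h1⟩ := hval
  rw [cf.eq_2 (-c), cf.eq_2 (-0), cf_neg_one_cons_sub_one
    (by push_cast; intro h; apply h0; linarith) (by push_cast; intro h; linarith)]
  push_cast
  generalize cf (c :: m) = t at *
  have h2 : 0 < t + 1 := by linarith
  have : (1 : ℚ) / (-0 - (1 / (0 - t) - 1)) = t / (t + 1) := by
    have h3 : (-0 : ℚ) - (1 / (0 - t) - 1) = (t + 1) / t := by
      field_simp
      ring
    rw [h3, one_div_div]
  rw [this]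
  refine ⟨fun hc => one_div_mem_of_le_neg_one ?_, fun hc => one_div_mem_of_one_le ?_⟩
  · have hcq : (1 : ℚ) ≤ c := by exact_mod_cast hc
    linarith [div_pos (hp hc).1 h2]
  · have hcq : (c : ℚ) ≤ -1 := by exact_mod_cast (by omega : c ≤ -1)
    linarith [div_neg_of_neg_of_pos (hn hc).2 h2]

theorem bPrime_cons (a : ℤ) (l : List ℤ) :
    bPrime (a :: l) = (l.map fun x => -x).reverse ++ (-a :: -1 :: (a - 1) :: l) := by
  simp [bPrime]

theorem SCFE.oppositeUnit_bPrime {b : List ℤ} (hb : SCFE b) :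
    OppositeUnit (b.getLastD 0) (cf (bPrime b)) := by
  cases b with
  | nil => exact absurd rfl hb.1
  | cons a l =>
    rw [bPrime_cons]
    by_cases ha : a = 0 ∨ a = 1
    · cases l with
      | nil =>
        have := hb.two_le_abs
        rcases ha with rfl | rfl <;> simp at this
      | cons c m =>
        obtain ⟨-, hc, ht⟩ := hb.tail
        have hturn : OppositeUnit c (cf (-c :: -a :: -1 :: (a - 1) :: c :: m)) := by
          rcases ha with rfl | rfl
          · exact hb.oppositeUnit_turn_zero
          · exact hb.oppositeUnit_turn_one
        simpa using hturn.reverse_append ht hc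
    · push Not at ha
      exact (hb.oppositeUnit_turn ha.1 ha.2).reverse_append hb ha.1

/-- for a SCFE `(b_1, …, b_k)` with value `≠ ±1` and
`b' = (−b_k, …, −b_1, −1, b_1 − 1, b_2, …, b_k)`, if `|N + cf(b')| < 1` for an integer `N`
then `N = 0` or `N = sgn(b_k)`. -/
theorem which_N (b : List ℤ) (hb : SCFE b)
    (h1 : cf b ≠ 1) (h2 : cf b ≠ -1) (N : ℤ)
    (hN : |(N : ℚ) + cf (bPrime b)| < 1) :
    N = 0 ∨ N = Int.sign (b.getLastD 0) := by
  refine hb.oppositeUnit_bPrime.eq_zero_or_eq_sign (fun h => ?_) hN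
  have := hb.2.2.2
  rw [h] at this
  norm_num at this
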